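/- For every natural number n and every x ∈ [−1, 1], the derivative of the Legendre polynomial satisfies |P_n'(x)| ≤ n(n+1)/2. Consequently, max_{x∈[−1,1]} |P_n'(x)| = P_n'(1) = n(n+1)/2. -/

import Mathlib

/-- The `n`-th Legendre polynomial, given by Rodrigues' formula. -/
noncomputable def legendreP (n : ℕ) (x : ℝ) : ℝ :=
  (1 / (2 ^ n * n.factorial : ℝ)) * iteratedDeriv n (fun t : ℝ => (t ^ 2 - 1) ^ n) x

open Polynomial in
/-- The unnormalized Legendre polynomial, the `n`-th derivative of `(X ^ 2 - 1) ^ n`. -/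
noncomputable def rodriguesPoly (n : ℕ) : ℝ[X] :=
  derivative^[n] ((X ^ 2 - 1) ^ n)

namespace rodriguesPoly

open Polynomial

theorem iterate_derivative_succ_X_mul (k : ℕ) (p : ℝ[X]) :
    derivative^[k + 1] (X * p) = X * derivative^[k + 1] p + ((k : ℝ[X]) + 1) * derivative^[k] p := by
  induction k with
  | zero => simp [add_comm]
  | succ k ih =>
    rw [Function.iterate_succ_apply', ih]
    simp only [Function.iterate_succ_apply', derivative_add, derivative_mul, derivative_X,
      derivative_natCast, derivative_one]
    push_cast
    ring

theorem succ_eq_iterate_derivative_X_mul (n : ℕ) :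
    rodriguesPoly (n + 1) = 2 * ((n : ℝ[X]) + 1) * derivative^[n] (X * (X ^ 2 - 1) ^ n) := by
  have h : derivative ((X ^ 2 - 1 : ℝ[X]) ^ (n + 1))
      = C (2 * (n + 1 : ℝ)) * (X * (X ^ 2 - 1) ^ n) := by
    simp [derivative_pow, map_ofNat]
    ring
  rw [rodriguesPoly, Function.iterate_succ_apply, h, iterate_derivative_C_mul]
  simp [map_ofNat]

theorem derivative_succ (n : ℕ) :
    derivative (rodriguesPoly (n + 1)) =
      2 * ((n : ℝ[X]) + 1) * (X * derivative (rodriguesPoly n) + ((n : ℝ[X]) + 1) * rodriguesPoly n) := by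
  have h : (2 * (n + 1) : ℝ[X]) = C (2 * (n + 1 : ℝ)) := by simp [map_ofNat]
  rw [succ_eq_iterate_derivative_X_mul, h, derivative_C_mul,
    ← Function.iterate_succ_apply' (⇑derivative), iterate_derivative_succ_X_mul, Function.iterate_succ_apply', rodriguesPoly]

theorem succ (n : ℕ) :
    rodriguesPoly (n + 1) =
      2 * ((X ^ 2 - 1) * derivative (rodriguesPoly n) + ((n : ℝ[X]) + 1) * X * rodriguesPoly n) := by
  have h := succ_eq_iterate_derivative_X_mul n
  have h' : rodriguesPoly (n + 1) = derivative^[n + 1] (X * (X * (X ^ 2 - 1) ^ n))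
      - derivative^[n + 1] ((X ^ 2 - 1) ^ n) := by
    rw [rodriguesPoly, ← iterate_derivative_sub]
    congr 1
    ring
  rw [iterate_derivative_succ_X_mul, iterate_derivative_succ_X_mul,
    Function.iterate_succ_apply', ← rodriguesPoly] at h'
  linear_combination 2 * h' - h

end rodriguesPoly

theorem legendreP_eq_eval (n : ℕ) :
    legendreP n =
      fun x => 1 / (2 ^ n * n.factorial : ℝ) * (rodriguesPoly n).eval x := by
  have h (k : ℕ) (p : Polynomial ℝ) :
      iteratedDeriv k (fun x => p.eval x) = fun x => (Polynomial.derivative^[k] p).eval x := by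
    induction k with
    | zero => simp
    | succ k ih =>
      ext x
      rw [iteratedDeriv_succ, ih, Polynomial.deriv, Function.iterate_succ_apply']
  ext x
  have hp := congrFun (h n ((Polynomial.X ^ 2 - 1) ^ n)) x
  simp only [Polynomial.eval_pow, Polynomial.eval_sub, Polynomial.eval_X,
    Polynomial.eval_one] at hp
  rw [legendreP, hp, rodriguesPoly]

theorem deriv_legendreP_eq_eval (n : ℕ) (x : ℝ) :
    deriv (legendreP n) x =
      1 / (2 ^ n * n.factorial : ℝ) * (Polynomial.derivative (rodriguesPoly n)).eval x := by
  rw [legendreP_eq_eval, deriv_const_mul _ (Polynomial.differentiableAt _), Polynomial.deriv]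

theorem legendreP_zero (x : ℝ) : legendreP 0 x = 1 := by
  simp [legendreP]

theorem deriv_legendreP_zero (x : ℝ) : deriv (legendreP 0) x = 0 := by
  simp [funext legendreP_zero]

theorem legendreP_succ (n : ℕ) (x : ℝ) :
    legendreP (n + 1) x =
      x * legendreP n x + (x ^ 2 - 1) * (deriv (legendreP n) x / (n + 1)) := by
  rw [deriv_legendreP_eq_eval]
  simp only [legendreP_eq_eval, rodriguesPoly.succ, Nat.factorial_succ]
  simp
  field_simp
  ring

theorem deriv_legendreP_succ (n : ℕ) (x : ℝ) :
    deriv (legendreP (n + 1)) x = x * deriv (legendreP n) x + (n + 1) * legendreP n x := by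
  rw [deriv_legendreP_eq_eval, deriv_legendreP_eq_eval]
  simp only [legendreP_eq_eval, rodriguesPoly.derivative_succ, Nat.factorial_succ]
  simp
  field_simp
  ring

theorem legendreP_one (n : ℕ) : legendreP n 1 = 1 := by
  induction n with
  | zero => exact legendreP_zero 1
  | succ n ih => simp [legendreP_succ, ih]

theorem deriv_legendreP_one (n : ℕ) : deriv (legendreP n) 1 = n * (n + 1) / 2 := by
  induction n with
  | zero => simp [deriv_legendreP_zero]
  | succ n ih =>
    rw [deriv_legendreP_succ, ih, legendreP_one]
    push_cast
    ring

/-- The recurrences rotate `(P_n, √(1 - x²) P_n' / (n + 1))` by the angle `arccos x`, which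
makes this energy nonincreasing in `n`. -/
theorem legendreP_sq_add_le_one (n : ℕ) {x : ℝ} (hx : x ^ 2 ≤ 1) :
    legendreP n x ^ 2 + (1 - x ^ 2) * (deriv (legendreP n) x / (n + 1)) ^ 2 ≤ 1 := by
  induction n with
  | zero => simp [legendreP_zero, deriv_legendreP_zero]
  | succ n ih =>
    have hn : (n + 1 : ℝ) ≠ 0 := by positivity
    have hle : (deriv (legendreP (n + 1)) x / ((n + 1 : ℕ) + 1)) ^ 2 ≤
        (deriv (legendreP (n + 1)) x / (n + 1)) ^ 2 := by
      rw [div_pow, div_pow]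
      gcongr
      simp
    have hd : deriv (legendreP (n + 1)) x / (n + 1) =
        x * (deriv (legendreP n) x / (n + 1)) + legendreP n x := by
      rw [deriv_legendreP_succ]
      field_simp
    calc _ ≤ legendreP (n + 1) x ^ 2
          + (1 - x ^ 2) * (deriv (legendreP (n + 1)) x / (n + 1)) ^ 2 := by
          gcongr
      _ = legendreP n x ^ 2 + (1 - x ^ 2) * (deriv (legendreP n) x / (n + 1)) ^ 2 := by
          rw [hd, legendreP_succ]
          ring
      _ ≤ 1 := ih

theorem abs_legendreP_le_one (n : ℕ) {x : ℝ} (hx : |x| ≤ 1) : |legendreP n x| ≤ 1 := by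
  have hx2 : x ^ 2 ≤ 1 := (sq_le_one_iff_abs_le_one x).2 hx
  rw [← sq_le_one_iff_abs_le_one]
  have := mul_nonneg (sub_nonneg.2 hx2) (sq_nonneg (deriv (legendreP n) x / (n + 1)))
  linarith [legendreP_sq_add_le_one n hx2]

theorem abs_deriv_legendreP_le (n : ℕ) {x : ℝ} (hx : |x| ≤ 1) :
    |deriv (legendreP n) x| ≤ n * (n + 1) / 2 := by
  induction n with
  | zero => simp [deriv_legendreP_zero]
  | succ n ih =>
    rw [deriv_legendreP_succ]
    calc |x * deriv (legendreP n) x + (n + 1) * legendreP n x|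
        ≤ |x| * |deriv (legendreP n) x| + (n + 1) * |legendreP n x| := by
          refine (abs_add_le _ _).trans_eq ?_
          rw [abs_mul, abs_mul, abs_of_nonneg (by positivity : (0 : ℝ) ≤ n + 1)]
      _ ≤ 1 * (n * (n + 1) / 2) + (n + 1) * 1 := by
          gcongr
          exact abs_legendreP_le_one n hx
      _ = _ := by
          push_cast
          ring

/-- Bound for the derivative of the Legendre polynomial on `[-1,1]`:
`|P_n'(x)| ≤ n(n+1)/2`, with equality (hence the maximum) attained at `x = 1`. -/
theorem stmt_12 (n : ℕ) :
    (∀ x ∈ Set.Icc (-1 : ℝ) 1, |deriv (legendreP n) x| ≤ n * (n + 1) / 2) ∧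
    deriv (legendreP n) 1 = n * (n + 1) / 2 ∧
    IsMaxOn (fun x => |deriv (legendreP n) x|) (Set.Icc (-1 : ℝ) 1) 1 := by
  have hbound : ∀ x ∈ Set.Icc (-1 : ℝ) 1, |deriv (legendreP n) x| ≤ n * (n + 1) / 2 :=
    fun x hx => abs_deriv_legendreP_le n (abs_le.2 hx)
  refine ⟨hbound, deriv_legendreP_one n, fun x hx => (hbound x hx).trans ?_⟩
  rw [← deriv_legendreP_one]
  exact le_abs_self _
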